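/- Parseval theorem for the fermionic Fourier transform: for all f, g ∈ Λ_{2n}, ∫_{B,x} f(x)·conj(g(x)) = ∫_{B,y} F^±_{0|2n}(f)(y)·conj(F^±_{0|2n}(g)(y)), where conj denotes complex conjugation of the coefficients (leaving the Grassmann generators unchanged). -/

import Mathlib

open scoped BigOperators
open Finset MeasureTheory

noncomputable section

/-- The Grassmann algebra on `N` anticommuting generators with coefficients in a
commutative ring `R`, represented by its coefficients with respect to the basis of
increasingly-ordered monomials, indexed by subsets of the generators. -/
abbrev Gr (R : Type) (N : ℕ) : Type := Finset (Fin N) → R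

namespace Gr

variable {R : Type} [CommRing R] {N : ℕ}

/-- The sign produced when reordering the concatenation of the ordered monomials indexed
by `A` and `B` into the ordered monomial indexed by `A ∪ B`. -/
def msign (A B : Finset (Fin N)) : R :=
  (-1 : R) ^ (((A ×ˢ B).filter fun p => p.2 < p.1).card)

/-- Multiplication of the Grassmann algebra. -/
def mul (f g : Gr R N) : Gr R N :=
  fun s => ∑ A ∈ s.powerset, msign A (s \ A) * f A * g (s \ A)

/-- The unit of the Grassmann algebra. -/
def one : Gr R N := fun s => if s = (∅ : Finset (Fin N)) then 1 else 0

/-- The `j`-th generator of the Grassmann algebra. -/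
def gen (j : Fin N) : Gr R N := fun s => if s = {j} then 1 else 0

/-- Powers in the Grassmann algebra. -/
def pow (f : Gr R N) : ℕ → Gr R N
  | 0 => one
  | k + 1 => mul (pow f k) f

/-- The left partial derivative `∂_j`, i.e. the odd derivation with `∂_j(x_k) = δ_{jk}`. -/
def pderiv (j : Fin N) (f : Gr R N) : Gr R N :=
  fun s => if j ∈ s then 0
    else (-1 : R) ^ ((s.filter fun i => i < j).card) * f (insert j s)

/-- The exponential of a Grassmann algebra element with nilpotent (zero-constant-term)
argument: the series terminates, and all terms beyond degree `N` vanish. -/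
def gexp (f : Gr ℂ N) : Gr ℂ N :=
  ∑ k ∈ Finset.range (N + 1), ((k.factorial : ℂ))⁻¹ • pow f k

/-- Iterated left partial derivatives: the first element of the list acts first. -/
def derivList (l : List (Fin N)) (f : Gr R N) : Gr R N :=
  l.foldl (fun g j => pderiv j g) f

/-- Complex conjugation of the coefficients. -/
def gconj (f : Gr ℂ N) : Gr ℂ N := fun s => (starRingEnd ℂ) (f s)

end Gr

/-- The Lean index of the paper's generator `x`_{2j-1}` (j = 1,…,n). -/
def lo (n : ℕ) (j : Fin n) : Fin (2 * n) := ⟨2 * (j : ℕ), by have := j.isLt; omega⟩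

/-- The Lean index of the paper's generator `x`_{2j}` (j = 1,…,n). -/
def hi (n : ℕ) (j : Fin n) : Fin (2 * n) := ⟨2 * (j : ℕ) + 1, by have := j.isLt; omega⟩

/-- `x`² = Σ_{j=1}^n x`_{2j-1} x`_{2j}`. -/
def xsq (n : ℕ) : Gr ℂ (2 * n) := ∑ j : Fin n, Gr.mul (Gr.gen (lo n j)) (Gr.gen (hi n j))

/-- The fermionic Laplace operator `Δ_f = 4 Σ_{j=1}^n ∂_{x`_{2j-1}} ∂_{x`_{2j}}`. -/
def lapF (n : ℕ) (f : Gr ℂ (2 * n)) : Gr ℂ (2 * n) :=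
  (4 : ℂ) • ∑ j : Fin n, Gr.pderiv (lo n j) (Gr.pderiv (hi n j) f)

/-- The Berezin integral `∫_B = π^{-n} ∂_{x`_{2n}} ⋯ ∂_{x`_1}`. -/
def berezin (n : ℕ) (f : Gr ℂ (2 * n)) : ℂ :=
  ((Real.pi : ℂ) ^ n)⁻¹ * Gr.derivList (List.finRange (2 * n)) f ∅

/-- The fermionic Gaussian `exp(x`²/2) = Σ_{j=0}^n (x`²)^j/(2^j j!)`. -/
def fermGauss (n : ℕ) : Gr ℂ (2 * n) :=
  ∑ j ∈ Finset.range (n + 1), (((2 : ℂ) ^ j * j.factorial)⁻¹) • Gr.pow (xsq n) j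

/-- Embedding of the `x` generators into the Grassmann algebra on the `4n` generators
`x`_1, …, x`_{2n}, y`_1, …, y`_{2n}` (the `x` generators come first). -/
def xi (n : ℕ) (t : Fin (2 * n)) : Fin (2 * n + 2 * n) := Fin.castAdd (2 * n) t

/-- Embedding of the `y` generators into the Grassmann algebra on the `4n` generators. -/
def yi (n : ℕ) (t : Fin (2 * n)) : Fin (2 * n + 2 * n) := Fin.natAdd (2 * n) t

/-- The algebra embedding `Λ_{2n} → Λ_{4n}` sending the generators to the `x` generators. -/
def embX (n : ℕ) (f : Gr ℂ (2 * n)) : Gr ℂ (2 * n + 2 * n) :=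
  fun s => ∑ A : Finset (Fin (2 * n)), if s = A.image (xi n) then f A else 0

/-- The Berezin integral with respect to the `x` variables,
`π^{-n} ∂_{x`_{2n}} ⋯ ∂_{x`_1}`, inside the mixed algebra `Λ_{4n}`. -/
def berezinX (n : ℕ) (F : Gr ℂ (2 * n + 2 * n)) : Gr ℂ (2 * n + 2 * n) :=
  ((Real.pi : ℂ) ^ n)⁻¹ • Gr.derivList ((List.finRange (2 * n)).map (xi n)) F

/-- The fermionic Fourier kernel
`K^σ(x, y) = exp(-σ (i/2) Σ_{j=1}^n (x`_{2j-1} y`_{2j} - x`_{2j} y`_{2j-1}))`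
(for the plus sign `σ = 1`, for the minus sign `σ = -1`). -/
def fermK (n : ℕ) (σ : ℂ) : Gr ℂ (2 * n + 2 * n) :=
  Gr.gexp ((-σ * (Complex.I / 2)) • ∑ j : Fin n,
    (Gr.mul (Gr.gen (xi n (lo n j))) (Gr.gen (yi n (hi n j))) -
     Gr.mul (Gr.gen (xi n (hi n j))) (Gr.gen (yi n (lo n j)))))

/-- The fermionic Fourier transform
`F^σ_{0|2n}(g)(y) = (2π)^n ∫_{B,x} K^σ(x,y) g(x)`, an element of the Grassmann algebra
in the `y` variables, identified with `Λ_{2n}`. -/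
def fermFT (n : ℕ) (σ : ℂ) (g : Gr ℂ (2 * n)) : Gr ℂ (2 * n) :=
  fun s => (((2 * Real.pi : ℝ) : ℂ) ^ n) *
    berezinX n (Gr.mul (fermK n σ) (embX n g)) (s.image (yi n))


end

namespace Gr

variable {N : ℕ}

/-- The sign of the transposition sorting the pair `(i, j)`. -/
def pairSign (i j : Fin N) : ℂ := if j < i then -1 else 1

lemma msign_eq_prod (A B : Finset (Fin N)) :
    (msign A B : ℂ) = ∏ a ∈ A, ∏ b ∈ B, pairSign a b := by
  rw [msign, ← prod_const, prod_filter, prod_product]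
  rfl

/-- The ordered monomial indexed by a set of generators. -/
def mono (A : Finset (Fin N)) : Gr ℂ N := fun s => if s = A then 1 else 0

lemma mul_sum_smul {ι : Type*} (s : Finset ι) (F : Gr ℂ N) (c : ι → ℂ) (G : ι → Gr ℂ N) :
    mul F (∑ i ∈ s, c i • G i) = ∑ i ∈ s, c i • mul F (G i) := by
  ext S
  simp only [mul, Finset.sum_apply, Pi.smul_apply, smul_eq_mul, Finset.mul_sum]
  rw [sum_comm]
  exact sum_congr rfl fun _ _ => sum_congr rfl fun _ _ => by ring

lemma sum_smul_mul {ι : Type*} (s : Finset ι) (F : Gr ℂ N) (c : ι → ℂ) (G : ι → Gr ℂ N) :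
    mul (∑ i ∈ s, c i • G i) F = ∑ i ∈ s, c i • mul (G i) F := by
  ext S
  simp only [mul, Finset.sum_apply, Pi.smul_apply, smul_eq_mul, Finset.mul_sum, Finset.sum_mul]
  rw [sum_comm]
  exact sum_congr rfl fun _ _ => sum_congr rfl fun _ _ => by ring

lemma smul_mul (c : ℂ) (F G : Gr ℂ N) : mul (c • F) G = c • mul F G := by
  simpa using sum_smul_mul {()} G (fun _ => c) fun _ => F

lemma mul_mono_mono (A B : Finset (Fin N)) :
    mul (mono A) (mono B) = if Disjoint A B then (msign A B : ℂ) • mono (A ∪ B) else 0 := by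
  ext S
  have key : ∀ C ∈ S.powerset, (msign C (S \ C) : ℂ) * mono A C * mono B (S \ C) =
      if C = A then (if S \ A = B then msign A B else 0) else 0 := by
    intro C _
    unfold mono
    split_ifs <;> simp_all
  rw [mul, sum_congr rfl key, sum_ite_eq']
  by_cases hd : Disjoint A B
  · rw [if_pos hd]
    simp only [mem_powerset, Pi.smul_apply, mono, smul_eq_mul]
    by_cases hS : S = A ∪ B
    · subst hS
      simp [union_sdiff_cancel_left hd]
    · rw [if_neg hS]
      split_ifs with h1 h2
      · exact absurd (by rw [← h2, union_sdiff_of_subset h1]) hS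
      all_goals simp
  · rw [if_neg hd]
    have : S \ A ≠ B := fun h => hd (h ▸ disjoint_sdiff)
    simp [this]

lemma derivList_apply_of_sorted (l : List (Fin N)) (hl : l.Pairwise (· < ·)) (f : Gr ℂ N)
    (s : Finset (Fin N)) (hs : ∀ i ∈ l, ∀ j ∈ s, i < j) :
    derivList l f s = f (l.toFinset ∪ s) := by
  induction l generalizing f with
  | nil => simp [derivList]
  | cons a l ih =>
    rw [List.pairwise_cons] at hl
    have ha : ∀ i ∈ l.toFinset ∪ s, a < i := by
      intro i hi
      rcases mem_union.1 hi with hi | hi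
      · exact hl.1 i (List.mem_toFinset.1 hi)
      · exact hs a (by simp) i hi
    have h1 : a ∉ l.toFinset ∪ s := fun h => lt_irrefl _ (ha a h)
    have h2 : (l.toFinset ∪ s).filter (· < a) = ∅ :=
      filter_eq_empty_iff.2 fun i hi => (ha i hi).not_gt
    change derivList l (pderiv a f) s = _
    rw [ih hl.2 _ fun i hi => hs i (by simp [hi]), pderiv, if_neg h1, h2]
    simp [insert_union]

end Gr

open Gr

lemma berezin_eq (n : ℕ) (f : Gr ℂ (2 * n)) :
    berezin n f = ((Real.pi : ℂ) ^ n)⁻¹ * f univ := by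
  rw [berezin, derivList_apply_of_sorted _ (List.pairwise_lt_finRange _) _ _ (by simp)]
  simp

lemma berezin_mul (n : ℕ) (f g : Gr ℂ (2 * n)) :
    berezin n (Gr.mul f g) =
      ((Real.pi : ℂ) ^ n)⁻¹ * ∑ A : Finset (Fin (2 * n)), msign A Aᶜ * f A * g Aᶜ := by
  rw [berezin_eq, Gr.mul, powerset_univ]
  rfl

lemma berezinX_apply (n : ℕ) (F : Gr ℂ (2 * n + 2 * n)) (s : Finset (Fin (2 * n))) :
    berezinX n F (s.image (yi n)) =
      ((Real.pi : ℂ) ^ n)⁻¹ * F (univ.image (xi n) ∪ s.image (yi n)) := by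
  have h : ((List.finRange (2 * n)).map (xi n)).Pairwise (· < ·) :=
    (List.pairwise_lt_finRange _).map _ fun _ _ h => h
  rw [berezinX, Pi.smul_apply, derivList_apply_of_sorted _ h]
  · congr 3
  · simp only [List.mem_map, mem_image]
    rintro _ ⟨a, _, rfl⟩ _ ⟨b, _, rfl⟩
    simp only [xi, yi, Fin.lt_def, Fin.val_castAdd, Fin.val_natAdd]
    omega

namespace FermKernel

variable {n : ℕ}

/-- The involution exchanging `lo j` and `hi j`. -/
def flip (t : Fin (2 * n)) : Fin (2 * n) :=
  ⟨if (t : ℕ) % 2 = 0 then t + 1 else t - 1, by have := t.isLt; split_ifs <;> omega⟩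

lemma flip_involutive : Function.Involutive (flip (n := n)) := by
  intro t
  simp only [flip, Fin.ext_iff]
  split_ifs <;> omega

lemma flip_lo (j : Fin n) : flip (lo n j) = hi n j := by
  simp [flip, lo, hi]

lemma flip_hi (j : Fin n) : flip (hi n j) = lo n j := by
  simp [flip, lo, hi]

/-- Reindexing of monomials along `flip`. -/
def flipSet (T : Finset (Fin (2 * n))) : Finset (Fin (2 * n)) := T.image flip

lemma flipSet_involutive : Function.Involutive (flipSet (n := n)) := by
  intro T
  simp [flipSet, image_image, flip_involutive.comp_self]

lemma flipSet_compl (T : Finset (Fin (2 * n))) : (flipSet T)ᶜ = flipSet Tᶜ := by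
  ext t
  simp only [flipSet, mem_compl, mem_image]
  constructor
  · exact fun h => ⟨flip t, fun h' => h ⟨_, h', flip_involutive t⟩, flip_involutive t⟩
  · rintro ⟨u, hu, rfl⟩ ⟨v, hv, h⟩
    exact hu (flip_involutive.injective h ▸ hv)

lemma sumElim_lo_hi_bijective : Function.Bijective (Sum.elim (lo n) (hi n)) := by
  rw [Fintype.bijective_iff_injective_and_card]
  constructor
  · rintro (a | a) (b | b) h <;> simp [lo, hi, Fin.ext_iff] at h ⊢ <;> omega
  · simp; omega

lemma sum_eq_sum_lo_add_hi {M : Type*} [AddCommMonoid M] (f : Fin (2 * n) → M) :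
    ∑ t, f t = ∑ j, (f (lo n j) + f (hi n j)) := by
  rw [← sumElim_lo_hi_bijective.sum_comp, Fintype.sum_sum_type, sum_add_distrib]
  rfl

/-- The sign acquired when two of the terms `x_s y_{flip s}` and `x_t y_{flip t}` are
brought into normal order. -/
def crossSign (s t : Fin (2 * n)) : ℂ := -(pairSign s t * pairSign (flip s) (flip t))

lemma crossSign_comm {s t : Fin (2 * n)} (h : s ≠ t) : crossSign s t = crossSign t s := by
  have h' := flip_involutive.injective.ne h
  simp only [crossSign, pairSign]
  rcases lt_or_gt_of_ne h with h | h <;> rcases lt_or_gt_of_ne h' with h' | h' <;>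
    simp [h, h', h.not_gt, h'.not_gt]

lemma crossSign_lo_hi (j : Fin n) : crossSign (lo n j) (hi n j) = 1 := by
  rw [crossSign, flip_lo, flip_hi]
  simp [pairSign, lo, hi]

lemma crossSign_lo_mul_hi (s : Fin (2 * n)) (j : Fin n) (h1 : s ≠ lo n j) (h2 : s ≠ hi n j) :
    crossSign s (lo n j) * crossSign s (hi n j) = 1 := by
  have e1 : pairSign s (lo n j) = pairSign s (hi n j) := by
    simp only [pairSign, lo, hi, Fin.lt_def, Ne, Fin.ext_iff] at *
    congr 1
    simp only [eq_iff_iff]; omega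
  have e2 : pairSign (flip s) (lo n j) = pairSign (flip s) (hi n j) := by
    simp only [pairSign, lo, hi, Fin.lt_def, Ne, Fin.ext_iff, flip] at *
    congr 1
    split_ifs <;> simp only [eq_iff_iff] <;> omega
  rw [crossSign, crossSign, flip_lo, flip_hi, e1, e2]
  simp only [pairSign]
  split_ifs <;> norm_num

/-- The coefficient of `x_t y_{flip t}` in the exponent of the kernel with parameter `a`. -/
def expCoeff (a : ℂ) (t : Fin (2 * n)) : ℂ := if (t : ℕ) % 2 = 0 then a else -a

lemma expCoeff_lo (a : ℂ) (j : Fin n) : expCoeff a (lo n j) = a := by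
  simp [expCoeff, lo]

lemma expCoeff_hi (a : ℂ) (j : Fin n) : expCoeff a (hi n j) = -a := by
  simp [expCoeff, hi]

/-- The coefficient of the monomial `xyMono T` in the kernel with parameter `a`. -/
def kerCoeff (a : ℂ) (T : Finset (Fin (2 * n))) : ℂ :=
  (∏ t ∈ T, expCoeff a t) * ∏ s ∈ T, ∏ t ∈ T, if s < t then crossSign s t else 1

lemma kerCoeff_union (a : ℂ) {A B : Finset (Fin (2 * n))} (h : Disjoint A B) :
    kerCoeff a (A ∪ B) =
      kerCoeff a A * kerCoeff a B * ∏ s ∈ A, ∏ t ∈ B, crossSign s t := by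
  have hc : ∏ s ∈ A, ∏ t ∈ B, crossSign s t =
      (∏ s ∈ A, ∏ t ∈ B, if s < t then crossSign s t else 1) *
        ∏ s ∈ B, ∏ t ∈ A, if s < t then crossSign s t else 1 := by
    rw [prod_comm (s := B), ← prod_mul_distrib]
    refine prod_congr rfl fun s hs => ?_
    rw [← prod_mul_distrib]
    refine prod_congr rfl fun t ht => ?_
    have hne : s ≠ t := fun e => disjoint_left.1 h hs (e ▸ ht)
    rcases lt_or_gt_of_ne hne with h | h
    · simp [h, h.not_gt]
    · simp [h, h.not_gt, crossSign_comm hne]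
  simp only [kerCoeff, prod_union h, prod_mul_distrib, hc]
  ring

lemma kerCoeff_singleton (a : ℂ) (t : Fin (2 * n)) : kerCoeff a {t} = expCoeff a t := by
  simp [kerCoeff]

lemma kerCoeff_blocks (a : ℂ) (J : Finset (Fin n)) :
    kerCoeff a (J.image (lo n) ∪ J.image (hi n)) = (-(a * a)) ^ #J := by
  induction J using Finset.induction_on with
  | empty => simp [kerCoeff]
  | insert j J hj ih =>
    have hlh : lo n j ≠ hi n j := by simp [lo, hi]
    have hne : ∀ s ∈ J.image (lo n) ∪ J.image (hi n), s ≠ lo n j ∧ s ≠ hi n j := by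
      intro s hs
      simp only [mem_union, mem_image] at hs
      rcases hs with ⟨i, hi', rfl⟩ | ⟨i, hi', rfl⟩ <;>
      · have : (i : ℕ) ≠ j := fun e => hj (Fin.ext e ▸ hi')
        simp only [lo, hi, Ne, Fin.ext_iff]
        omega
    have hset : (insert j J).image (lo n) ∪ (insert j J).image (hi n) =
        (J.image (lo n) ∪ J.image (hi n)) ∪ ({lo n j} ∪ {hi n j}) := by
      ext; simp only [image_insert, mem_union, mem_insert, mem_singleton]; tauto
    have hd : Disjoint (J.image (lo n) ∪ J.image (hi n)) ({lo n j} ∪ {hi n j}) := by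
      rw [disjoint_left]
      intro s hs
      simpa using hne s hs
    have hcross : ∏ s ∈ J.image (lo n) ∪ J.image (hi n), ∏ t ∈ {lo n j} ∪ {hi n j},
        crossSign s t = 1 := by
      refine prod_eq_one fun s hs => ?_
      rw [prod_union (disjoint_singleton.2 hlh), prod_singleton, prod_singleton,
        crossSign_lo_mul_hi s j (hne s hs).1 (hne s hs).2]
    rw [hset, kerCoeff_union a hd, kerCoeff_union a (disjoint_singleton.2 hlh), ih, hcross,
      kerCoeff_singleton, kerCoeff_singleton, expCoeff_lo, expCoeff_hi, card_insert_of_notMem hj]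
    simp [crossSign_lo_hi, pow_succ]

lemma kerCoeff_univ (a : ℂ) : kerCoeff a (univ : Finset (Fin (2 * n))) = (-(a * a)) ^ n := by
  have h : (univ : Finset (Fin (2 * n))) = univ.image (lo n) ∪ univ.image (hi n) := by
    ext t
    obtain ⟨j | j, rfl⟩ := sumElim_lo_hi_bijective.surjective t <;> simp
  rw [h, kerCoeff_blocks]
  simp

lemma crossSign_real (s t : Fin (2 * n)) : (starRingEnd ℂ) (crossSign s t) = crossSign s t := by
  simp only [crossSign, pairSign]
  split_ifs <;> simp

lemma conj_kerCoeff {a : ℂ} (ha : (starRingEnd ℂ) a = -a) (T : Finset (Fin (2 * n))) :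
    (starRingEnd ℂ) (kerCoeff a T) = (-1) ^ #T * kerCoeff a T := by
  have h : ∀ t : Fin (2 * n), (starRingEnd ℂ) (expCoeff a t) = -1 * expCoeff a t := by
    intro t
    unfold expCoeff
    split_ifs <;> simp [ha]
  simp only [kerCoeff, map_mul, map_prod, apply_ite (starRingEnd ℂ), crossSign_real, map_one, h,
    prod_mul_distrib, prod_const, mul_assoc]

/-- The index set of the monomial `∏_{t ∈ T} x_t y_{flip t}` in normal order. -/
def xyMono (T : Finset (Fin (2 * n))) : Finset (Fin (2 * n + 2 * n)) :=
  T.image (xi n) ∪ (flipSet T).image (yi n)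

lemma xi_injective : Function.Injective (xi n) := Fin.castAdd_injective _ _

lemma yi_injective : Function.Injective (yi n) := Fin.natAdd_injective _ _

lemma xi_ne_yi (s t : Fin (2 * n)) : xi n s ≠ yi n t := by
  have := s.isLt
  simp only [xi, yi, Ne, Fin.ext_iff, Fin.val_castAdd, Fin.val_natAdd]
  omega

lemma disjoint_image_xi_yi (A B : Finset (Fin (2 * n))) :
    Disjoint (A.image (xi n)) (B.image (yi n)) := by
  rw [disjoint_left]
  simp only [mem_image]
  rintro _ ⟨s, _, rfl⟩ ⟨t, _, h⟩
  exact xi_ne_yi _ _ h.symm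

lemma image_xi_union_yi_inj {A B A' B' : Finset (Fin (2 * n))} :
    A.image (xi n) ∪ B.image (yi n) = A'.image (xi n) ∪ B'.image (yi n) ↔ A = A' ∧ B = B' := by
  refine ⟨fun h => ⟨?_, ?_⟩, by rintro ⟨rfl, rfl⟩; rfl⟩
  · ext t
    simpa [xi_injective.eq_iff, (xi_ne_yi _ _).symm] using Finset.ext_iff.1 h (xi n t)
  · ext t
    simpa [yi_injective.eq_iff, xi_ne_yi] using Finset.ext_iff.1 h (yi n t)

lemma msign_xi_yi_union (A B C D : Finset (Fin (2 * n))) :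
    (msign (A.image (xi n) ∪ B.image (yi n)) (C.image (xi n) ∪ D.image (yi n)) : ℂ) =
      msign A C * (-1) ^ (#B * #C) * msign B D := by
  have h1 : ∀ s t : Fin (2 * n), pairSign (xi n s) (xi n t) = pairSign s t := fun _ _ => rfl
  have h2 : ∀ s t : Fin (2 * n), pairSign (yi n s) (yi n t) = pairSign s t := by
    intro s t
    simp [pairSign, yi]
  have h3 : ∀ s t : Fin (2 * n), pairSign (xi n s) (yi n t) = 1 := by
    intro s t
    have := s.isLt
    simp only [pairSign, xi, yi, Fin.lt_def, Fin.val_castAdd, Fin.val_natAdd]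
    rw [if_neg (by omega)]
  have h4 : ∀ s t : Fin (2 * n), pairSign (yi n s) (xi n t) = -1 := by
    intro s t
    have := t.isLt
    simp only [pairSign, xi, yi, Fin.lt_def, Fin.val_castAdd, Fin.val_natAdd]
    rw [if_pos (by omega)]
  simp only [msign_eq_prod, prod_union (disjoint_image_xi_yi _ _),
    prod_image xi_injective.injOn, prod_image yi_injective.injOn, h1, h2, h3, h4,
    prod_mul_distrib, prod_const, ← pow_mul]
  rw [mul_comm #C]
  ring

lemma msign_flipSet (A B : Finset (Fin (2 * n))) :
    (msign (flipSet A) (flipSet B) : ℂ) = ∏ s ∈ A, ∏ t ∈ B, pairSign (flip s) (flip t) := by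
  rw [msign_eq_prod]
  simp only [flipSet, prod_image flip_involutive.injective.injOn]

lemma prod_crossSign (A B : Finset (Fin (2 * n))) :
    ∏ s ∈ A, ∏ t ∈ B, crossSign s t =
      (-1) ^ (#A * #B) * msign A B * msign (flipSet A) (flipSet B) := by
  have h : ∀ s t : Fin (2 * n), crossSign s t =
      -1 * pairSign s t * pairSign (flip s) (flip t) := by
    intro s t
    rw [crossSign]; ring
  rw [msign_flipSet, msign_eq_prod]
  simp only [h, prod_mul_distrib, prod_const, ← pow_mul]
  rw [mul_comm #B]

lemma card_flipSet (T : Finset (Fin (2 * n))) : #(flipSet T) = #T :=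
  card_image_of_injective _ flip_involutive.injective

lemma msign_xyMono (A B : Finset (Fin (2 * n))) :
    (msign (xyMono A) (xyMono B) : ℂ) = ∏ s ∈ A, ∏ t ∈ B, crossSign s t := by
  rw [xyMono, xyMono, msign_xi_yi_union, prod_crossSign, card_flipSet]
  ring

lemma xyMono_union (A B : Finset (Fin (2 * n))) : xyMono (A ∪ B) = xyMono A ∪ xyMono B := by
  simp only [xyMono, flipSet, image_union]
  ac_rfl

lemma disjoint_xyMono {A B : Finset (Fin (2 * n))} :
    Disjoint (xyMono A) (xyMono B) ↔ Disjoint A B := by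
  simp only [xyMono, disjoint_union_left, disjoint_union_right, disjoint_image_xi_yi,
    (disjoint_image_xi_yi _ _).symm, disjoint_image xi_injective, disjoint_image yi_injective,
    flipSet, disjoint_image flip_involutive.injective]
  tauto

lemma mul_gen_gen_xi_yi (t : Fin (2 * n)) :
    Gr.mul (Gr.gen (xi n t)) (Gr.gen (yi n (flip t))) = mono (xyMono {t}) := by
  have hd : Disjoint {xi n t} {yi n (flip t)} := disjoint_singleton.2 (xi_ne_yi _ _)
  have hs := msign_xi_yi_union {t} ∅ ∅ {flip t}
  have h1 : (msign ({t} : Finset (Fin (2 * n))) ∅ : ℂ) = 1 := by simp [msign]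
  have h2 : (msign (∅ : Finset (Fin (2 * n))) {flip t} : ℂ) = 1 := by simp [msign]
  simp only [image_singleton, image_empty, union_empty, empty_union, card_empty, mul_zero,
    pow_zero, mul_one, h1, h2] at hs
  change Gr.mul (mono {xi n t}) (mono {yi n (flip t)}) = _
  rw [mul_mono_mono, if_pos hd, hs, one_smul]
  simp [xyMono, flipSet]

/-- The exponent of the Fourier kernel. -/
def exponent (n : ℕ) (a : ℂ) : Gr ℂ (2 * n + 2 * n) :=
  ∑ t : Fin (2 * n), expCoeff a t • mono (xyMono {t})

lemma fermK_eq (σ : ℂ) : fermK n σ = Gr.gexp (exponent n (-σ * (Complex.I / 2))) := by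
  rw [fermK, exponent, sum_eq_sum_lo_add_hi, smul_sum]
  congr 1
  refine sum_congr rfl fun j _ => ?_
  rw [← mul_gen_gen_xi_yi, ← mul_gen_gen_xi_yi, flip_lo, flip_hi, expCoeff_lo, expCoeff_hi,
    smul_sub, neg_smul, sub_eq_add_neg]

lemma kerCoeff_smul_mul_mono (a : ℂ) (T : Finset (Fin (2 * n))) (t : Fin (2 * n)) :
    (kerCoeff a T * expCoeff a t) • Gr.mul (mono (xyMono T)) (mono (xyMono {t})) =
      if t ∈ T then 0 else kerCoeff a (insert t T) • mono (xyMono (insert t T)) := by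
  simp only [mul_mono_mono, disjoint_xyMono, disjoint_singleton_right]
  by_cases ht : t ∈ T
  · simp [ht]
  · have hd : Disjoint T {t} := disjoint_singleton_right.2 ht
    rw [if_pos ht, if_neg ht, smul_smul, msign_xyMono, insert_eq, union_comm {t}, xyMono_union,
      kerCoeff_union a hd, kerCoeff_singleton]

lemma sum_powersetCard_insert {α M : Type*} [Fintype α] [DecidableEq α] [AddCommMonoid M]
    (k : ℕ) (G : Finset α → M) :
    ∑ T ∈ powersetCard k univ, ∑ t, (if t ∈ T then 0 else G (insert t T)) =
      (k + 1) • ∑ T ∈ powersetCard (k + 1) univ, G T := by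
  have hL : ∀ T : Finset α, ∑ t, (if t ∈ T then 0 else G (insert t T)) =
      ∑ t ∈ Tᶜ, G (insert t T) := by
    intro T
    simp only [← ite_not (_ ∈ T), ← sum_filter]
    exact sum_congr (by ext; simp) fun _ _ => rfl
  have hR : ∀ T ∈ powersetCard (k + 1) (univ : Finset α), (k + 1) • G T = ∑ _t ∈ T, G T := by
    intro T hT
    rw [sum_const, (mem_powersetCard.1 hT).2]
  rw [smul_sum, sum_congr rfl hR, sum_congr rfl fun T _ => hL T, sum_sigma', sum_sigma']
  refine sum_bij' (fun p _ => ⟨insert p.2 p.1, p.2⟩) (fun p _ => ⟨p.1.erase p.2, p.2⟩)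
    ?_ ?_ ?_ ?_ ?_
  · rintro ⟨T, t⟩ h
    simp only [mem_sigma, mem_powersetCard_univ, mem_compl] at h ⊢
    exact ⟨by rw [card_insert_of_notMem h.2, h.1], mem_insert_self _ _⟩
  · rintro ⟨T, t⟩ h
    simp only [mem_sigma, mem_powersetCard_univ, mem_compl] at h ⊢
    exact ⟨by rw [card_erase_of_mem h.2, h.1, Nat.add_sub_cancel], notMem_erase _ _⟩
  · rintro ⟨T, t⟩ h
    simp only [mem_sigma, mem_compl] at h
    simp [erase_insert h.2]
  · rintro ⟨T, t⟩ h
    simp only [mem_sigma] at h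
    simp [insert_erase h.2]
  · exact fun _ _ => rfl

lemma pow_exponent (a : ℂ) (k : ℕ) :
    Gr.pow (exponent n a) k = (k.factorial : ℂ) •
      ∑ T ∈ powersetCard k univ, kerCoeff a T • mono (xyMono T) := by
  induction k with
  | zero =>
    ext s
    simp [Gr.pow, Gr.one, kerCoeff, mono, xyMono, flipSet]
  | succ k ih =>
    have hstep : Gr.mul (∑ T ∈ powersetCard k univ, kerCoeff a T • mono (xyMono T))
        (exponent n a) =
        (k + 1) • ∑ T ∈ powersetCard (k + 1) univ, kerCoeff a T • mono (xyMono T) := by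
      rw [sum_smul_mul, ← sum_powersetCard_insert k fun T => kerCoeff a T • mono (xyMono T)]
      refine sum_congr rfl fun T _ => ?_
      rw [exponent, mul_sum_smul, smul_sum]
      exact sum_congr rfl fun t _ => by rw [smul_smul, kerCoeff_smul_mul_mono]
    rw [Gr.pow, ih, smul_mul, hstep, ← Nat.cast_smul_eq_nsmul ℂ, smul_smul, Nat.factorial_succ,
      Nat.cast_mul, mul_comm (k.factorial : ℂ)]

lemma gexp_exponent (a : ℂ) :
    Gr.gexp (exponent n a) = ∑ T, kerCoeff a T • mono (xyMono T) := by
  have hmaps : ∀ T ∈ (univ : Finset (Finset (Fin (2 * n)))), #T ∈ range (2 * n + 2 * n + 1) := by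
    intro T _
    have := card_le_univ T
    rw [Fintype.card_fin] at this
    rw [mem_range]
    omega
  rw [Gr.gexp, ← sum_fiberwise_of_maps_to hmaps]
  refine sum_congr rfl fun k _ => ?_
  rw [pow_exponent, smul_smul, inv_mul_cancel₀ (by exact_mod_cast k.factorial_ne_zero), one_smul,
    univ_filter_card_eq]

lemma embX_eq (g : Gr ℂ (2 * n)) : embX n g = ∑ A, g A • mono (A.image (xi n)) := by
  ext s
  simp [embX, mono]

lemma mul_xyMono_apply (T U A : Finset (Fin (2 * n))) :
    Gr.mul (mono (xyMono U)) (mono (A.image (xi n)))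
        (univ.image (xi n) ∪ (flipSet T).image (yi n)) =
      if U = T then if A = Tᶜ then msign T Tᶜ * (-1 : ℂ) ^ (#T * #Tᶜ) else 0 else 0 := by
  have hd : Disjoint (xyMono U) (A.image (xi n)) ↔ Disjoint U A := by
    rw [xyMono, disjoint_union_left, disjoint_image xi_injective,
      and_iff_left (disjoint_image_xi_yi _ _).symm]
  have hu : xyMono U ∪ A.image (xi n) = (U ∪ A).image (xi n) ∪ (flipSet U).image (yi n) := by
    rw [xyMono, image_union, union_right_comm]
  have hs : (msign (xyMono U) (A.image (xi n)) : ℂ) = msign U A * (-1) ^ (#U * #A) := by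
    have := msign_xi_yi_union U (flipSet U) A ∅
    rw [image_empty, union_empty, card_flipSet] at this
    rw [xyMono, this]
    simp [msign]
  rw [mul_mono_mono]
  simp only [hd, hu, hs]
  by_cases h : U = T ∧ A = Tᶜ
  · obtain ⟨rfl, rfl⟩ := h
    simp [disjoint_compl_right, mono]
  · have hz : ¬ (Disjoint U A ∧ univ = U ∪ A ∧ flipSet T = flipSet U) := by
      rintro ⟨h1, h2, h3⟩
      obtain rfl := flipSet_involutive.injective h3
      refine h ⟨rfl, ?_⟩
      exact (IsCompl.compl_eq ⟨h1, codisjoint_iff.2 h2.symm⟩).symm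
    rw [← ite_and, if_neg h]
    split_ifs with h1
    · simp only [Pi.smul_apply, mono, image_xi_union_yi_inj]
      rw [if_neg fun h2 => hz ⟨h1, h2⟩, smul_zero]
    · rfl

lemma fermFT_apply_flipSet (σ : ℂ) (g : Gr ℂ (2 * n)) (T : Finset (Fin (2 * n))) :
    fermFT n σ g (flipSet T) = 2 ^ n * kerCoeff (-σ * (Complex.I / 2)) T *
      (msign T Tᶜ * (-1) ^ (#T * #Tᶜ)) * g Tᶜ := by
  have hpi : ((Real.pi : ℂ) ^ n) ≠ 0 := pow_ne_zero _ (by exact_mod_cast Real.pi_ne_zero)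
  have hmul : Gr.mul (fermK n σ) (embX n g) (univ.image (xi n) ∪ (flipSet T).image (yi n)) =
      kerCoeff (-σ * (Complex.I / 2)) T * (g Tᶜ * (msign T Tᶜ * (-1) ^ (#T * #Tᶜ))) := by
    rw [fermK_eq, gexp_exponent, embX_eq, sum_smul_mul]
    simp only [mul_sum_smul, Finset.sum_apply, Pi.smul_apply, mul_xyMono_apply, smul_eq_mul]
    simp [mul_ite]
  rw [fermFT, berezinX_apply, hmul]
  push_cast
  rw [mul_pow]
  field_simp

lemma parseval_sign {a : ℂ} (ha : (starRingEnd ℂ) a = -a) (h4 : 4 * (-(a * a)) = 1)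
    (T : Finset (Fin (2 * n))) :
    4 ^ n * kerCoeff a T * (starRingEnd ℂ) (kerCoeff a Tᶜ) * msign (flipSet T) (flipSet Tᶜ) *
      msign T Tᶜ = 1 := by
  have hu := kerCoeff_union a (disjoint_compl_right (a := T))
  rw [union_compl, kerCoeff_univ, prod_crossSign] at hu
  have hcard : #T + #Tᶜ = 2 * n := by simp [card_add_card_compl]
  have heven : Even (#T * #Tᶜ + #Tᶜ) := by
    have : Even (#T + #Tᶜ) := by rw [hcard]; exact even_two_mul n
    rw [Nat.even_add] at this
    rw [Nat.even_add, Nat.even_mul]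
    tauto
  have hsign : ((-1 : ℂ) ^ #Tᶜ) = (-1) ^ (#T * #Tᶜ) := by
    rw [← mul_right_inj' (pow_ne_zero (#T * #Tᶜ) (neg_ne_zero.2 (one_ne_zero (α := ℂ)))),
      ← pow_add, heven.neg_one_pow, ← mul_pow]
    simp
  have h1 : (4 : ℂ) ^ n * (-(a * a)) ^ n = 1 := by rw [← mul_pow, h4, one_pow]
  rw [hu] at h1
  rw [conj_kerCoeff ha, hsign]
  linear_combination h1

end FermKernel

open FermKernel

/-- Parseval theorem for the fermionic Fourier transform: for all `f, g ∈ Λ_{2n}`,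
`∫_{B,x} f(x) conj(g(x)) = ∫_{B,y} F^±(f)(y) conj(F^±(g)(y))` (sign `σ = ±1`), where
`conj` conjugates the complex coefficients and leaves the Grassmann generators unchanged. -/
theorem fermFT_parseval (n : ℕ) (σ : ℂ) (hσ : σ = 1 ∨ σ = -1) (f g : Gr ℂ (2 * n)) :
    berezin n (Gr.mul f (Gr.gconj g)) =
      berezin n (Gr.mul (fermFT n σ f) (Gr.gconj (fermFT n σ g))) := by
  set a : ℂ := -σ * (Complex.I / 2) with ha
  have hconj : (starRingEnd ℂ) a = -a := by
    rcases hσ with rfl | rfl <;> simp [ha, neg_div, map_ofNat]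
  have h4 : 4 * (-(a * a)) = 1 := by
    have hσ2 : σ ^ 2 = 1 := by rcases hσ with rfl | rfl <;> norm_num
    rw [ha]
    linear_combination (-σ ^ 2) * Complex.I_sq + hσ2
  rw [berezin_mul, berezin_mul]
  congr 1
  rw [← flipSet_involutive.bijective.sum_comp fun A =>
      (msign A Aᶜ : ℂ) * fermFT n σ f A * gconj (fermFT n σ g) Aᶜ,
    ← (compl_involutive (α := Finset (Fin (2 * n)))).bijective.sum_comp]
  refine sum_congr rfl fun T _ => ?_
  rw [flipSet_compl, gconj, gconj, fermFT_apply_flipSet, fermFT_apply_flipSet, ← ha, compl_compl]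
  have hreal : (starRingEnd ℂ) (msign Tᶜ T) = msign Tᶜ T := by simp [msign]
  have hneg : ((-1 : ℂ) ^ (#T * #Tᶜ)) * (-1) ^ (#T * #Tᶜ) = 1 := by rw [← mul_pow]; simp
  have h22 : (2 : ℂ) ^ n * 2 ^ n = 4 ^ n := by rw [← mul_pow]; norm_num
  have key := parseval_sign hconj h4 T
  simp only [map_mul, map_pow, hreal, map_neg, map_one, map_ofNat, mul_comm #Tᶜ]
  rw [← h22] at key
  linear_combination (-(msign Tᶜ T * f Tᶜ * (starRingEnd ℂ) (g T))) * (key +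
    2 ^ n * 2 ^ n * kerCoeff a T * (starRingEnd ℂ) (kerCoeff a Tᶜ) *
      msign (flipSet T) (flipSet Tᶜ) * msign T Tᶜ * hneg)
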